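/- Let n ≥ 3, let U ⊆ ℝ^n be open with coordinates (x₁, …, x_n), and let φ₁, …, φ_{n−1} : U → ℂ be twice continuously differentiable. Define the complex 1-form ω = Σ_{k=1}^n h_k dx_k where h₁ = φ₁² + … + φ_{n−2}² − φ_{n−1}², h₂ = i(φ₁² + … + φ_{n−2}² + φ_{n−1}²), and h_k = 2φ_{k−2}φ_{n−1} for k = 3, …, n. Define X_a = φ_a(x₁ + i x₂) + φ_{n−1} x_{a+2} for a = 1, …, n−2, X_{n−1} = −φ_{n−1}(x₁ − i x₂) + φ₁ x₃ + φ₂ x₄ + … + φ_{n−2} x_n, and the complex 1-form η = Σ_{i=1}^{n−1} X_i dφ_i (with coefficient η_k = Σ_i X_i ∂φ_i/∂x_k in dx_k). Then dω = −2 dη; explicitly, ∂ω_k/∂x_j − ∂ω_j/∂x_k = −2(∂η_k/∂x_j − ∂η_j/∂x_k) on U for all j, k. In particular ω is closed if and only if η is closed. -/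

import Mathlib

open Complex Finset

/-- Partial derivative of a complex-valued function on `ℝⁿ` in the `k`-th coordinate
direction. -/
noncomputable def pdC {n : ℕ} (f : (Fin n → ℝ) → ℂ) (k : Fin n) (x : Fin n → ℝ) : ℂ :=
  fderiv ℝ f x (Pi.single k 1)

section PartialDerivative

variable {n : ℕ} {f g : (Fin n → ℝ) → ℂ} {x : Fin n → ℝ} {k : Fin n}

theorem pdC_add (hf : DifferentiableAt ℝ f x) (hg : DifferentiableAt ℝ g x) :
    pdC (fun p => f p + g p) k x = pdC f k x + pdC g k x := by
  simp [pdC, fderiv_fun_add hf hg]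

theorem pdC_sub (hf : DifferentiableAt ℝ f x) (hg : DifferentiableAt ℝ g x) :
    pdC (fun p => f p - g p) k x = pdC f k x - pdC g k x := by
  simp [pdC, fderiv_fun_sub hf hg]

theorem pdC_mul (hf : DifferentiableAt ℝ f x) (hg : DifferentiableAt ℝ g x) :
    pdC (fun p => f p * g p) k x = f x * pdC g k x + pdC f k x * g x := by
  simp [pdC, fderiv_fun_mul hf hg, mul_comm]

theorem pdC_const_mul (c : ℂ) (hf : DifferentiableAt ℝ f x) :
    pdC (fun p => c * f p) k x = c * pdC f k x := by
  simp [pdC, fderiv_const_mul hf c]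

theorem pdC_sq (hf : DifferentiableAt ℝ f x) :
    pdC (fun p => f p ^ 2) k x = 2 * f x * pdC f k x := by
  simp only [pow_two]
  rw [pdC_mul hf hf]
  ring

theorem pdC_sum {ι : Type*} {s : Finset ι} {F : ι → (Fin n → ℝ) → ℂ}
    (hF : ∀ i ∈ s, DifferentiableAt ℝ (F i) x) :
    pdC (fun p => ∑ i ∈ s, F i p) k x = ∑ i ∈ s, pdC (F i) k x := by
  simp [pdC, fderiv_fun_sum hF]

theorem contDiff_ofReal_apply (l : Fin n) {r : WithTop ℕ∞} :
    ContDiff ℝ r (fun p : Fin n → ℝ => (p l : ℂ)) :=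
  Complex.ofRealCLM.contDiff.comp (contDiff_apply ℝ ℝ l)

theorem pdC_ofReal_apply (l : Fin n) :
    pdC (fun p => (p l : ℂ)) k x = if l = k then 1 else 0 := by
  have h : HasFDerivAt (fun p : Fin n → ℝ => (p l : ℂ))
      (Complex.ofRealCLM.comp (ContinuousLinearMap.proj l)) x :=
    (Complex.ofRealCLM.comp
      (ContinuousLinearMap.proj (R := ℝ) (φ := fun _ : Fin n => ℝ) l)).hasFDerivAt
  rw [pdC, h.fderiv]
  by_cases hlk : l = k
  · subst hlk; simp
  · simp [hlk]

theorem pdC_congr {U : Set (Fin n → ℝ)} (hU : IsOpen U) (hx : x ∈ U)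
    (h : ∀ p ∈ U, f p = g p) : pdC f k x = pdC g k x := by
  rw [pdC, pdC, Filter.EventuallyEq.fderiv_eq (Filter.mem_of_superset (hU.mem_nhds hx) h)]

theorem differentiableAt_pdC (hf : ContDiffAt ℝ 2 f x) : DifferentiableAt ℝ (pdC f k) x :=
  ((hf.fderiv_right (m := 1) (by norm_num)).differentiableAt (by norm_num)).clm_apply
    (differentiableAt_const _)

theorem pdC_pdC_comm (hf : ContDiffAt ℝ 2 f x) (j : Fin n) :
    pdC (pdC f k) j x = pdC (pdC f j) k x := by
  have hd : DifferentiableAt ℝ (fderiv ℝ f) x :=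
    (hf.fderiv_right (m := 1) (by norm_num)).differentiableAt (by norm_num)
  have key (a b : Fin n) : pdC (pdC f a) b x =
      fderiv ℝ (fderiv ℝ f) x (Pi.single b 1) (Pi.single a 1) := by
    have := fderiv_clm_apply hd (differentiableAt_const (Pi.single a (1 : ℝ)))
    unfold pdC
    rw [this]
    simp
  rw [key, key]
  exact (hf.isSymmSndFDerivAt (by simp)) _ _

/-- If `dQ = ω + c η` for a `C²` function `Q` and a differentiable `ω`, with `c ≠ 0`, then
`dω = -c dη`. -/
theorem pdC_sub_pdC_eq_of_pdC_eq_add {U : Set (Fin n → ℝ)} (hU : IsOpen U)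
    {Q : (Fin n → ℝ) → ℂ} (hQ : ContDiffOn ℝ 2 Q U) {ω η : Fin n → (Fin n → ℝ) → ℂ}
    (hω : ∀ k, DifferentiableOn ℝ (ω k) U) {c : ℂ} (hc : c ≠ 0)
    (h : ∀ p ∈ U, ∀ k, pdC Q k p = ω k p + c * η k p) (hx : x ∈ U) (j k : Fin n) :
    pdC (ω k) j x - pdC (ω j) k x = -c * (pdC (η k) j x - pdC (η j) k x) := by
  have hQx := hQ.contDiffAt (hU.mem_nhds hx)
  have hωx (a : Fin n) : DifferentiableAt ℝ (ω a) x := (hω a).differentiableAt (hU.mem_nhds hx)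
  have key (a b : Fin n) : pdC (η a) b x = c⁻¹ * (pdC (pdC Q a) b x - pdC (ω a) b x) := by
    rw [← pdC_sub (differentiableAt_pdC hQx) (hωx a),
      ← pdC_const_mul _ ((differentiableAt_pdC hQx).fun_sub (hωx a))]
    refine pdC_congr hU hx fun p hp => ?_
    rw [h p hp a]
    field_simp
    ring
  rw [key, key, pdC_pdC_comm hQx]
  field_simp
  ring

/-- The product rule for the contraction of a `1`-form with the position vector field. -/
theorem pdC_sum_mul_ofReal_apply {ω : Fin n → (Fin n → ℝ) → ℂ}
    (hω : ∀ l, DifferentiableAt ℝ (ω l) x) :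
    pdC (fun p => ∑ l, ω l p * (p l : ℂ)) k x = ω k x + ∑ l, pdC (ω l) k x * (x l : ℂ) := by
  have hp (l : Fin n) : DifferentiableAt ℝ (fun p : Fin n → ℝ => (p l : ℂ)) x :=
    (contDiff_ofReal_apply l (r := 1)).contDiffAt.differentiableAt (by norm_num)
  rw [pdC_sum fun l _ => (hω l).fun_mul (hp l)]
  simp_rw [pdC_mul (hω _) (hp _), pdC_ofReal_apply]
  simp [Finset.sum_add_distrib]

end PartialDerivative

/-- general `n ≥ 3` version of the integrability condition.  Coordinates and
the `φ`'s are indexed from `0`, i.e. `x_{k+1}` of the paper is `p k` and `φ_{i+1}` of the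
paper is `φ i`.  With `ω = ∑ h_k dx_k` given by the spinor-like parametrization and
`η = ∑ X_i dφ_i` given by the stated `X`'s, one has `dω = −2 dη` componentwise on `U`;
in particular `ω` is closed iff `η` is closed. -/
theorem dOmega_eq_neg_two_dEta (n : ℕ) (hn : 3 ≤ n) (U : Set (Fin n → ℝ)) (hU : IsOpen U)
    (φ : Fin (n - 1) → (Fin n → ℝ) → ℂ)
    (hφ : ∀ i, ContDiffOn ℝ 2 (φ i) U)
    (ω : Fin n → (Fin n → ℝ) → ℂ)
    (hω1 : ∀ p, ω ⟨0, by omega⟩ p =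
      (∑ a : Fin (n - 2), φ (Fin.castLE (by omega) a) p ^ 2) - φ ⟨n - 2, by omega⟩ p ^ 2)
    (hω2 : ∀ p, ω ⟨1, by omega⟩ p =
      Complex.I *
        ((∑ a : Fin (n - 2), φ (Fin.castLE (by omega) a) p ^ 2) + φ ⟨n - 2, by omega⟩ p ^ 2))
    (hωk : ∀ (k : Fin n), 2 ≤ (k : ℕ) → ∀ p, ω k p =
      2 * φ ⟨(k : ℕ) - 2, by have := k.isLt; omega⟩ p * φ ⟨n - 2, by omega⟩ p)
    (X : Fin (n - 1) → (Fin n → ℝ) → ℂ)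
    (hXa : ∀ (a : Fin (n - 1)) (ha : (a : ℕ) < n - 2), ∀ p, X a p =
      φ a p * ((p ⟨0, by omega⟩ : ℂ) + Complex.I * (p ⟨1, by omega⟩ : ℂ)) +
        φ ⟨n - 2, by omega⟩ p * (p ⟨(a : ℕ) + 2, by have := a.isLt; omega⟩ : ℂ))
    (hXlast : ∀ p, X ⟨n - 2, by omega⟩ p =
      -φ ⟨n - 2, by omega⟩ p * ((p ⟨0, by omega⟩ : ℂ) - Complex.I * (p ⟨1, by omega⟩ : ℂ)) +
        ∑ a : Fin (n - 2),
          φ (Fin.castLE (by omega) a) p * (p ⟨(a : ℕ) + 2, by have := a.isLt; omega⟩ : ℂ))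
    (η : Fin n → (Fin n → ℝ) → ℂ)
    (hη : ∀ k p, η k p = ∑ i : Fin (n - 1), X i p * pdC (φ i) k p) :
    (∀ x ∈ U, ∀ j k : Fin n,
        pdC (ω k) j x - pdC (ω j) k x = -2 * (pdC (η k) j x - pdC (η j) k x)) ∧
    ((∀ x ∈ U, ∀ j k : Fin n, pdC (ω k) j x - pdC (ω j) k x = 0) ↔
      (∀ x ∈ U, ∀ j k : Fin n, pdC (η k) j x - pdC (η j) k x = 0)) := by
  have main : ∀ x ∈ U, ∀ j k : Fin n,
      pdC (ω k) j x - pdC (ω j) k x = -2 * (pdC (η k) j x - pdC (η j) k x) := by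
    obtain ⟨m, rfl⟩ : ∃ m, n = m + 3 := ⟨n - 3, by omega⟩
    change Fin (m + 2) → (Fin (m + 3) → ℝ) → ℂ at φ
    change Fin (m + 2) → (Fin (m + 3) → ℝ) → ℂ at X
    set L := φ (Fin.last (m + 1))
    let ψ : Fin (m + 1) → (Fin (m + 3) → ℝ) → ℂ := fun a => φ a.castSucc
    have e0 : ω 0 = fun p => (∑ a, ψ a p ^ 2) - L p ^ 2 := funext hω1
    have e1 : ω 1 = fun p => Complex.I * ((∑ a, ψ a p ^ 2) + L p ^ 2) := funext hω2
    have ek (a : Fin (m + 1)) : ω a.succ.succ = fun p => 2 * (ψ a p * L p) := by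
      funext p
      rw [← mul_assoc]
      exact hωk a.succ.succ (by simp) p
    have hψ (a : Fin (m + 1)) : ContDiffOn ℝ 2 (ψ a) U := hφ a.castSucc
    have hLU : ContDiffOn ℝ 2 L U := hφ (Fin.last (m + 1))
    have hω (k : Fin (m + 3)) : ContDiffOn ℝ 2 (ω k) U := by
      refine Fin.cases ?_ (Fin.cases ?_ fun a => ?_) k
      · rw [e0]
        exact (ContDiffOn.sum fun a _ => (hψ a).pow 2).sub (hLU.pow 2)
      · rw [Fin.succ_zero_eq_one, e1]
        exact contDiffOn_const.mul ((ContDiffOn.sum fun a _ => (hψ a).pow 2).add (hLU.pow 2))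
      · rw [ek]
        exact contDiffOn_const.mul ((hψ a).mul hLU)
    have hωd (k : Fin (m + 3)) : DifferentiableOn ℝ (ω k) U :=
      (hω k).differentiableOn (by norm_num)
    intro x hx j k
    refine pdC_sub_pdC_eq_of_pdC_eq_add hU (Q := fun p => ∑ l, ω l p * (p l : ℂ))
      (ContDiffOn.sum fun l _ => (hω l).mul (contDiff_ofReal_apply l).contDiffOn) hωd
      two_ne_zero (fun p hp k => ?_) hx j k
    have hU' := hU.mem_nhds hp
    have dψ (a : Fin (m + 1)) : DifferentiableAt ℝ (ψ a) p :=
      ((hψ a).contDiffAt hU').differentiableAt (by norm_num)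
    have dL : DifferentiableAt ℝ L p := (hLU.contDiffAt hU').differentiableAt (by norm_num)
    have dS : DifferentiableAt ℝ (fun p => ∑ a, ψ a p ^ 2) p :=
      DifferentiableAt.fun_sum fun a _ => (dψ a).fun_pow 2
    have hS : pdC (fun p => ∑ a, ψ a p ^ 2) k p = ∑ a, 2 * ψ a p * pdC (ψ a) k p := by
      rw [pdC_sum fun a _ => (dψ a).fun_pow 2]
      simp_rw [pdC_sq (dψ _)]
    have d0 : pdC (ω 0) k p =
        (∑ a, 2 * ψ a p * pdC (ψ a) k p) - 2 * L p * pdC L k p := by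
      rw [e0, pdC_sub dS (dL.fun_pow 2), hS, pdC_sq dL]
    have d1 : pdC (ω 1) k p =
        Complex.I * ((∑ a, 2 * ψ a p * pdC (ψ a) k p) + 2 * L p * pdC L k p) := by
      rw [e1, pdC_const_mul _ (dS.fun_add (dL.fun_pow 2)), pdC_add dS (dL.fun_pow 2), hS, pdC_sq dL]
    have dk (a : Fin (m + 1)) : pdC (ω a.succ.succ) k p =
        2 * (ψ a p * pdC L k p + pdC (ψ a) k p * L p) := by
      rw [ek, pdC_const_mul _ ((dψ a).fun_mul dL), pdC_mul (dψ a) dL]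
    have eX (a : Fin (m + 1)) : X a.castSucc p =
        ψ a p * ((p 0 : ℂ) + Complex.I * (p 1 : ℂ)) + L p * (p a.succ.succ : ℂ) :=
      hXa a.castSucc a.isLt p
    have eXl : X (Fin.last (m + 1)) p =
        -L p * ((p 0 : ℂ) - Complex.I * (p 1 : ℂ)) + ∑ a, ψ a p * (p a.succ.succ : ℂ) :=
      hXlast p
    have eη : η k p = (∑ a : Fin (m + 1), X a.castSucc p * pdC (ψ a) k p) +
        X (Fin.last (m + 1)) p * pdC L k p :=
      (hη k p).trans (Fin.sum_univ_castSucc _)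
    rw [pdC_sum_mul_ofReal_apply fun l => (hωd l).differentiableAt hU', eη,
      Fin.sum_univ_succ, Fin.sum_univ_succ, Fin.succ_zero_eq_one, d0, d1, eXl]
    simp_rw [dk, eX]
    have h1 : ∑ a, 2 * (ψ a p * pdC L k p + pdC (ψ a) k p * L p) * (p a.succ.succ : ℂ) =
        2 * (∑ a, ψ a p * (p a.succ.succ : ℂ)) * pdC L k p +
          2 * ∑ a, L p * (p a.succ.succ : ℂ) * pdC (ψ a) k p := by
      simp only [Finset.mul_sum, Finset.sum_mul, ← Finset.sum_add_distrib]
      exact Finset.sum_congr rfl fun a _ => by ring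
    have h2 : ∑ a, (ψ a p * ((p 0 : ℂ) + Complex.I * (p 1 : ℂ)) + L p * (p a.succ.succ : ℂ)) *
          pdC (ψ a) k p =
        (∑ a, ψ a p * pdC (ψ a) k p) * ((p 0 : ℂ) + Complex.I * (p 1 : ℂ)) +
          ∑ a, L p * (p a.succ.succ : ℂ) * pdC (ψ a) k p := by
      simp only [Finset.sum_mul, ← Finset.sum_add_distrib]
      exact Finset.sum_congr rfl fun a _ => by ring
    have h3 : ∑ a, 2 * ψ a p * pdC (ψ a) k p = 2 * ∑ a, ψ a p * pdC (ψ a) k p := by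
      simp only [Finset.mul_sum, mul_assoc]
    rw [h1, h2, h3]
    ring
  refine ⟨main, forall₄_congr fun x hx j k => ?_⟩
  rw [main x hx j k]
  simp
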